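/- arXiv:1211.1860 — 2 statements merged into one kernel-verified Lean document; each statement's English description precedes it below -/
import Mathlib

section
/- Let k ≥ 1, let v : {0,1,...,k} → ℝ be non-decreasing submodular with v(0) = 0, and let x, x* be integers with 1 ≤ x < x* ≤ k. Then v(x) + Σ_{j=1}^{x*−x} (v(x+j) − v(x))/(j + x) ≥ (1 + (x/x*)·ln(x/x*)) · v(x*) ≥ (1 − e^{−1}) · v(x*). -/
/-- Slopes of a sequence with non-increasing increments decrease: the chord of `v` over `[a, a + m]`
lies below `v` at every intermediate point `a + j`. -/
theorem mul_sub_le_mul_sub_of_increments_antitone {k : ℕ} {v : ℕ → ℝ}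
    (hsub : ∀ a c : ℕ, 1 ≤ a → a < c → c ≤ k → v c - v (c - 1) ≤ v a - v (a - 1))
    (a j m : ℕ) (hjm : j ≤ m) (hm : a + m ≤ k) :
    (j : ℝ) * (v (a + m) - v a) ≤ m * (v (a + j) - v a) := by
  have increment_le : ∀ i : ℕ, a + i + 1 ≤ k →
      (i : ℝ) * (v (a + i + 1) - v (a + i)) ≤ v (a + i) - v a := by
    intro i
    induction i with
    | zero => simp
    | succ i ih =>
      intro hi
      have h := hsub (a + i + 1) (a + (i + 1) + 1) (by omega) (by omega) hi
      simp only [Nat.add_sub_cancel, ← Nat.add_assoc] at h ⊢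
      have h' := ih (by omega)
      have h'' := mul_le_mul_of_nonneg_left h (by positivity : (0 : ℝ) ≤ i + 1)
      push_cast
      linarith
  induction m, hjm using Nat.le_induction with
  | base => rfl
  | succ m hjm ih =>
    rcases Nat.eq_zero_or_pos m with rfl | hpos
    · obtain rfl : j = 0 := by omega
      simp
    · have hm0 : (0 : ℝ) < m := by exact_mod_cast hpos
      have h1 := ih (by omega)
      have h2 := increment_le m (by omega)
      have h3 := mul_le_mul_of_nonneg_left h2 (Nat.cast_nonneg (α := ℝ) j)
      have h4 := mul_le_mul_of_nonneg_left h1 (by positivity : (0 : ℝ) ≤ m + 1)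
      refine le_of_mul_le_mul_left ?_ hm0
      rw [← Nat.add_assoc]
      push_cast
      linarith

theorem sum_inv_add_le_log {x : ℕ} (hx : 1 ≤ x) (m : ℕ) :
    ∑ j ∈ Finset.Icc 1 m, ((j : ℝ) + x)⁻¹ ≤ Real.log ((x + m : ℝ) / x) := by
  have hx0 : (0 : ℝ) < x := by exact_mod_cast hx
  induction m with
  | zero => simp [hx0.ne']
  | succ m ih =>
    rw [Finset.sum_Icc_succ_top (by omega)]
    have h := Real.one_sub_inv_le_log_of_pos
      (by positivity : 0 < ((x : ℝ) + m + 1) / (x + m))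
    have hsplit : ((x : ℝ) + (m + 1 : ℕ)) / x = (x + m) / x * ((x + m + 1) / (x + m)) := by
      push_cast
      field_simp
      ring
    have hinv : (((m + 1 : ℕ) : ℝ) + x)⁻¹ = 1 - (((x : ℝ) + m + 1) / (x + m))⁻¹ := by
      push_cast
      field_simp
      ring
    rw [hsplit, Real.log_mul (by positivity) (by positivity), hinv]
    linarith

theorem neg_exp_neg_one_le_mul_log {t : ℝ} (ht : 0 < t) : -Real.exp (-1) ≤ t * Real.log t := by
  have h := Real.log_le_sub_one_of_pos (by positivity : 0 < Real.exp (-1) / t)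
  rw [Real.log_div (by positivity) ht.ne', Real.log_exp] at h
  have h' := mul_le_mul_of_nonneg_left h ht.le
  have hcancel : t * (Real.exp (-1) / t) = Real.exp (-1) := by field_simp
  linarith


/-- For a non-decreasing submodular `v : {0,...,k} → ℝ` with `v 0 = 0`
and integers `1 ≤ x < x* ≤ k`:
`v(x) + Σ_{j=1}^{x*−x} (v(x+j) − v(x))/(j+x) ≥ (1 + (x/x*)·ln(x/x*))·v(x*) ≥ (1 − e⁻¹)·v(x*)`. -/
theorem stmt_7 (k : ℕ) (hk : 1 ≤ k) (v : ℕ → ℝ) (hv0 : v 0 = 0)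
    (hmono : ∀ a c : ℕ, a ≤ c → c ≤ k → v a ≤ v c)
    (hsub : ∀ a c : ℕ, 1 ≤ a → a < c → c ≤ k → v c - v (c - 1) ≤ v a - v (a - 1))
    (x xstar : ℕ) (hx : 1 ≤ x) (hxx : x < xstar) (hxk : xstar ≤ k) :
    (1 + ((x : ℝ) / (xstar : ℝ)) * Real.log ((x : ℝ) / (xstar : ℝ))) * v xstar ≤
        v x + ∑ j ∈ Finset.Icc 1 (xstar - x), (v (x + j) - v x) / ((j : ℝ) + (x : ℝ)) ∧
    (1 - Real.exp (-1)) * v xstar ≤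
        (1 + ((x : ℝ) / (xstar : ℝ)) * Real.log ((x : ℝ) / (xstar : ℝ))) * v xstar := by
  obtain ⟨m, rfl⟩ := Nat.exists_eq_add_of_lt hxx
  rw [Nat.add_assoc] at *
  generalize hM : m + 1 = M at *
  have hx0 : (0 : ℝ) < x := by exact_mod_cast hx
  have hM0 : (0 : ℝ) < M := by exact_mod_cast (by omega : 0 < M)
  have hV : 0 ≤ v (x + M) := hv0 ▸ hmono 0 (x + M) (Nat.zero_le _) hxk
  have hn0 : (0 : ℝ) < ((x + M : ℕ) : ℝ) := by positivity
  constructor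
  · have hstart : (x : ℝ) * v (x + M) ≤ (x + M) * v x := by
      have h := mul_sub_le_mul_sub_of_increments_antitone hsub 0 x (x + M) (by omega) (by omega)
      simpa [hv0] using h
    have hterm : ∀ j ∈ Finset.Icc 1 M, (v (x + M) - v x) / M * (1 - x * ((j : ℝ) + x)⁻¹) ≤
        (v (x + j) - v x) / ((j : ℝ) + x) := by
      intro j hj
      have h := mul_sub_le_mul_sub_of_increments_antitone hsub x j M (Finset.mem_Icc.mp hj).2 hxk
      have hj0 : (0 : ℝ) < (j : ℝ) + x := by positivity
      have hfactor : (v (x + M) - v x) / M * (1 - x * ((j : ℝ) + x)⁻¹) =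
          j * (v (x + M) - v x) / M / ((j : ℝ) + x) := by
        field_simp
        ring
      rw [hfactor]
      gcongr
      rw [div_le_iff₀ hM0]
      linarith
    have hsum := Finset.sum_le_sum hterm
    rw [← Finset.mul_sum, Finset.sum_sub_distrib, ← Finset.mul_sum] at hsum
    simp only [Finset.sum_const, Nat.card_Icc, Nat.add_sub_cancel, nsmul_eq_mul, mul_one] at hsum
    have hlog := sum_inv_add_le_log hx M
    have hlog0 : 0 ≤ Real.log ((x + M : ℝ) / x) :=
      Real.log_nonneg ((one_le_div hx0).2 (by linarith))
    have hneg : Real.log ((x : ℝ) / ((x + M : ℕ) : ℝ)) = -Real.log ((x + M : ℝ) / x) := by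
      rw [← Real.log_inv, inv_div]
      push_cast
      rfl
    rw [hneg, Nat.add_sub_cancel_left]
    refine le_trans ?_ (add_le_add_right hsum (v x))
    generalize Real.log ((x + M : ℝ) / x) = L at *
    generalize ∑ j ∈ Finset.Icc 1 M, ((j : ℝ) + x)⁻¹ = S at *
    have hslope0 : 0 ≤ (v (x + M) - v x) / M :=
      div_nonneg (sub_nonneg.2 (hmono x (x + M) (by omega) hxk)) hM0.le
    have hslope : (v (x + M) - v x) / M ≤ v (x + M) / ((x + M : ℕ) : ℝ) := by
      rw [div_le_div_iff₀ hM0 hn0]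
      push_cast
      linarith
    have hbound : (v (x + M) - v x) / M * (x * S) ≤ v (x + M) / ((x + M : ℕ) : ℝ) * (x * L) :=
      calc (v (x + M) - v x) / M * (x * S) ≤ (v (x + M) - v x) / M * (x * L) := by gcongr
        _ ≤ v (x + M) / ((x + M : ℕ) : ℝ) * (x * L) := by gcongr
    have hcancel : (v (x + M) - v x) / M * M = v (x + M) - v x := by field_simp
    have hrw : (1 + (x : ℝ) / ((x + M : ℕ) : ℝ) * -L) * v (x + M) =
        v (x + M) - v (x + M) / ((x + M : ℕ) : ℝ) * (x * L) := by
      ring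
    rw [hrw, mul_sub, hcancel]
    linarith
  · have h := neg_exp_neg_one_le_mul_log (div_pos hx0 hn0)
    exact mul_le_mul_of_nonneg_right (by linarith) hV
end

section
/- For every integer k ≥ 9, setting q = ⌊e^{−1}k − 1⌋ one has q ≥ 1, and (q/k)·(H_k − H_q) ≥ e^{−1} − 2/k, where H_m = Σ_{r=1}^m 1/r is the m-th harmonic number; consequently (1 − (q/k)(H_k − H_q))^{−1} ≥ (1 − e^{−1} + 2/k)^{−1}. -/
theorem log_sub_log_le_sum_one_div {q n : ℕ} (h : q ≤ n) :
    Real.log (n + 1) - Real.log (q + 1) ≤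
      ∑ r ∈ Finset.Icc 1 n, (1 : ℝ) / r - ∑ r ∈ Finset.Icc 1 q, (1 : ℝ) / r := by
  induction n, h using Nat.le_induction with
  | base => simp
  | succ n _ ih =>
    rw [Finset.sum_Icc_succ_top (by omega)]
    have hn : (0 : ℝ) < n + 1 := by positivity
    have hl := Real.log_le_sub_one_of_pos (x := ((n : ℝ) + 1 + 1) / (n + 1)) (by positivity)
    rw [Real.log_div (by positivity) hn.ne'] at hl
    have he : ((n : ℝ) + 1 + 1) / (n + 1) - 1 = 1 / (n + 1) := by
      field_simp
      ring
    push_cast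
    linarith

theorem mul_sum_one_div_sub_le {q n : ℕ} (h : q ≤ n) :
    (q : ℝ) * (∑ r ∈ Finset.Icc 1 n, (1 : ℝ) / r - ∑ r ∈ Finset.Icc 1 q, (1 : ℝ) / r) ≤
      n - q := by
  induction n, h using Nat.le_induction with
  | base => simp
  | succ n hqn ih =>
    rw [Finset.sum_Icc_succ_top (by omega)]
    have hqn' : (q : ℝ) ≤ n := by exact_mod_cast hqn
    have hterm : (q : ℝ) * (1 / (n + 1)) ≤ 1 := by
      rw [mul_one_div, div_le_one (by positivity)]
      linarith
    push_cast
    linarith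

/-- For every `k ≥ 9`, with `q = ⌊e⁻¹k − 1⌋` one has `q ≥ 1` and
`(q/k)·(H_k − H_q) ≥ e⁻¹ − 2/k`; consequently
`(1 − (q/k)(H_k − H_q))⁻¹ ≥ (1 − e⁻¹ + 2/k)⁻¹`. -/
theorem stmt_8 (k : ℕ) (hk : 9 ≤ k) :
    let q : ℕ := ⌊Real.exp (-1) * k - 1⌋₊
    let H : ℕ → ℝ := fun m => ∑ r ∈ Finset.Icc 1 m, (1 : ℝ) / r
    1 ≤ q ∧
    Real.exp (-1) - 2 / (k : ℝ) ≤ ((q : ℝ) / (k : ℝ)) * (H k - H q) ∧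
    (1 - Real.exp (-1) + 2 / (k : ℝ))⁻¹ ≤ (1 - ((q : ℝ) / (k : ℝ)) * (H k - H q))⁻¹ := by
  intro q H
  have hk9 : (9 : ℝ) ≤ k := by exact_mod_cast hk
  have hk0 : (0 : ℝ) < k := by linarith
  have hexp : (1 / 3 : ℝ) < Real.exp (-1) := by
    rw [Real.exp_neg, ← one_div]
    exact one_div_lt_one_div_of_lt (Real.exp_pos 1) Real.exp_one_lt_three
  have hexp_lt : Real.exp (-1) < 1 := Real.exp_lt_one_iff.2 (by norm_num)
  have hx : 1 ≤ Real.exp (-1) * k - 1 := by nlinarith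
  have hq1 : 1 ≤ q := Nat.le_floor (by exact_mod_cast hx)
  have hq1' : (1 : ℝ) ≤ q := by exact_mod_cast hq1
  have hq_le : (q : ℝ) ≤ Real.exp (-1) * k - 1 := Nat.floor_le (by linarith)
  have hq_lt : Real.exp (-1) * k - 1 < q + 1 := Nat.lt_floor_add_one _
  have hqk : q ≤ k := by
    have : (q : ℝ) ≤ k := by nlinarith
    exact_mod_cast this
  have hlog : Real.log (q + 1) ≤ -1 + Real.log k := by
    rw [← Real.log_exp (-1), ← Real.log_mul (Real.exp_pos _).ne' hk0.ne']
    exact Real.log_le_log (by positivity) (by linarith)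
  have hH : 1 ≤ H k - H q := by
    have := log_sub_log_le_sum_one_div hqk
    have := Real.log_le_log hk0 (by linarith : (k : ℝ) ≤ k + 1)
    simp only [H]
    linarith
  have hlower : Real.exp (-1) - 2 / (k : ℝ) ≤ ((q : ℝ) / (k : ℝ)) * (H k - H q) := by
    calc Real.exp (-1) - 2 / (k : ℝ) = (Real.exp (-1) * k - 2) / k := by field_simp
      _ ≤ q / k := by gcongr; linarith
      _ ≤ q / k * (H k - H q) := le_mul_of_one_le_right (by positivity) hH
  have hupper : ((q : ℝ) / (k : ℝ)) * (H k - H q) < 1 := by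
    rw [div_mul_eq_mul_div, div_lt_one hk0]
    have := mul_sum_one_div_sub_le hqk
    simp only [H]
    linarith
  exact ⟨hq1, hlower, inv_anti₀ (by linarith) (by linarith)⟩
end
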